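/- For every pair of real numbers (r₀,s₀) with r₀ + s₀ = 0, the function φ(x,y) = x^{r₀} y^{s₀} J₀(x), where J₀(x) = 1 + Σ_{n≥1} (−1)^n x^{2n} / (2^{2n}(n!)²), satisfies the Bessel PDE of type I: x² z_xx + 2xy z_xy + y² z_yy + x z_x + y z_y + x² z = 0 for x, y > 0. -/

import Mathlib

/-- Partial derivative in the first variable. -/
noncomputable def pdx (f : ℝ → ℝ → ℝ) : ℝ → ℝ → ℝ := fun x y => deriv (fun t => f t y) x

/-- Partial derivative in the second variable. -/
noncomputable def pdy (f : ℝ → ℝ → ℝ) : ℝ → ℝ → ℝ := fun x y => deriv (fun t => f x t) y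

/-- The Bessel function of the first kind of order zero,
`J₀(x) = Σ_{n≥0} (−1)ⁿ x^{2n}/(2^{2n}(n!)²)`. -/
noncomputable def J₀ (x : ℝ) : ℝ :=
  ∑' n : ℕ, (-1) ^ n * x ^ (2 * n) / (2 ^ (2 * n) * (Nat.factorial n) ^ 2)

/-- Termwise differentiation of a power series whose coefficients are dominated by `1 / n!`. -/
lemma hasDerivAt_tsum_mul_pow {c : ℕ → ℝ} (hc : ∀ n, |c n| ≤ 1 / n.factorial) (u : ℝ) :
    HasDerivAt (fun v => ∑' n, c n * v ^ n) (∑' n : ℕ, (n + 1) * c (n + 1) * u ^ n) u := by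
  set R := |u| + 1 with hR
  have hR0 : 0 ≤ R := by positivity
  have hu : u ∈ Metric.ball (0 : ℝ) R := by simp [hR]
  have hbound : Summable fun n : ℕ => (n : ℝ) * (1 / n.factorial) * R ^ (n - 1) := by
    rw [← summable_nat_add_iff 1]
    refine (Real.summable_pow_div_factorial R).congr fun n => ?_
    rw [Nat.factorial_succ]
    push_cast
    field_simp
  have hle : ∀ (n : ℕ) (v : ℝ), v ∈ Metric.ball (0 : ℝ) R →
      ‖(n : ℝ) * c n * v ^ (n - 1)‖ ≤ (n : ℝ) * (1 / n.factorial) * R ^ (n - 1) := by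
    intro n v hv
    have hv' : |v| ≤ R := by simpa using (Metric.mem_ball.mp hv).le
    rw [Real.norm_eq_abs, abs_mul, abs_mul, abs_pow, Nat.abs_cast]
    gcongr
    exact hc n
  have hderiv := hasDerivAt_tsum_of_isPreconnected (g := fun n v => c n * v ^ n)
    (g' := fun n v => (n : ℝ) * c n * v ^ (n - 1)) hbound Metric.isOpen_ball
    (convex_ball (0 : ℝ) R).isPreconnected
    (fun n v _ => ((hasDerivAt_pow n v).const_mul (c n)).congr_deriv (by ring)) hle
    (Metric.mem_ball_self (by positivity))
    (summable_of_ne_finset_zero (s := {0}) fun n hn => by simp_all) hu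
  refine hderiv.congr_deriv ?_
  rw [(Summable.of_norm_bounded hbound fun n => hle n u hu).tsum_eq_zero_add]
  simp

lemma summable_mul_pow {c : ℕ → ℝ} (hc : ∀ n, |c n| ≤ 1 / n.factorial) (u : ℝ) :
    Summable fun n => c n * u ^ n := by
  refine Summable.of_norm_bounded (Real.summable_pow_div_factorial |u|) fun n => ?_
  rw [Real.norm_eq_abs, abs_mul, abs_pow, div_eq_mul_one_div, mul_comm]
  gcongr
  exact hc n

lemma abs_succ_mul_le {c : ℕ → ℝ} (hc : ∀ n, |c n| ≤ 1 / n.factorial) (n : ℕ) :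
    |(n + 1) * c (n + 1)| ≤ 1 / n.factorial := by
  have h := hc (n + 1)
  rw [abs_mul, abs_of_nonneg (by positivity : (0 : ℝ) ≤ n + 1)]
  calc ((n : ℝ) + 1) * |c (n + 1)| ≤ (n + 1) * (1 / (n + 1).factorial) := by gcongr
    _ = 1 / n.factorial := by
      rw [Nat.factorial_succ]
      push_cast
      field_simp

/-- The coefficients of `J₀` as a power series in `x ^ 2`. -/
noncomputable def besselCoeff (n : ℕ) : ℝ := (-1) ^ n / (2 ^ (2 * n) * (n.factorial : ℝ) ^ 2)

lemma abs_besselCoeff_le (n : ℕ) : |besselCoeff n| ≤ 1 / n.factorial := by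
  have hf : (1 : ℝ) ≤ n.factorial := by exact_mod_cast n.factorial_pos
  have hp : (1 : ℝ) ≤ 2 ^ (2 * n) := one_le_pow₀ (by norm_num)
  rw [besselCoeff, abs_div, abs_pow, abs_neg, abs_one, one_pow,
    abs_of_pos (by positivity : (0 : ℝ) < 2 ^ (2 * n) * (n.factorial : ℝ) ^ 2)]
  gcongr
  nlinarith [mul_le_mul hp (le_self_pow₀ hf two_ne_zero) (by positivity) (by positivity)]

lemma besselCoeff_succ (n : ℕ) :
    4 * ((n : ℝ) + 1) ^ 2 * besselCoeff (n + 1) = -besselCoeff n := by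
  simp only [besselCoeff, Nat.factorial_succ]
  push_cast
  field_simp
  ring

lemma J₀_eq_tsum (x : ℝ) : J₀ x = ∑' n, besselCoeff n * (x ^ 2) ^ n := by
  refine tsum_congr fun n => ?_
  rw [besselCoeff, ← pow_mul]
  ring

/-- Bessel's equation of order zero, with the derivatives of `J₀` given by functions. -/
lemma exists_hasDerivAt_J₀ : ∃ dJ ddJ : ℝ → ℝ, (∀ x, HasDerivAt J₀ (dJ x) x) ∧
    (∀ x, HasDerivAt dJ (ddJ x) x) ∧
    ∀ x, x ^ 2 * ddJ x + x * dJ x + x ^ 2 * J₀ x = 0 := by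
  let b : ℕ → ℝ := fun n => (n + 1) * besselCoeff (n + 1)
  let d : ℕ → ℝ := fun n => (n + 1) * b (n + 1)
  have hb : ∀ n, |b n| ≤ 1 / n.factorial := abs_succ_mul_le abs_besselCoeff_le
  have hd : ∀ n, |d n| ≤ 1 / n.factorial := abs_succ_mul_le hb
  let F : ℝ → ℝ := fun u => ∑' n, besselCoeff n * u ^ n
  let dF : ℝ → ℝ := fun u => ∑' n, b n * u ^ n
  let ddF : ℝ → ℝ := fun u => ∑' n, d n * u ^ n
  have hF : ∀ u, HasDerivAt F (dF u) u := hasDerivAt_tsum_mul_pow abs_besselCoeff_le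
  have hdF : ∀ u, HasDerivAt dF (ddF u) u := hasDerivAt_tsum_mul_pow hb
  have hode : ∀ u, 4 * (u * ddF u + dF u) + F u = 0 := by
    intro u
    have hsum : Summable fun n : ℕ => (n : ℝ) * b n * u ^ n := by
      rw [← summable_nat_add_iff 1]
      refine ((summable_mul_pow hd u).mul_left u).congr fun n => ?_
      simp only [d]
      push_cast
      ring
    have hshift : u * ddF u = ∑' n : ℕ, (n : ℝ) * b n * u ^ n := by
      rw [hsum.tsum_eq_zero_add, ← tsum_mul_left]
      simp only [Nat.cast_zero, zero_mul, zero_add]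
      refine tsum_congr fun n => ?_
      simp only [d]
      push_cast
      ring
    rw [hshift, ← hsum.tsum_add (summable_mul_pow hb u), ← tsum_mul_left,
      ← ((hsum.add (summable_mul_pow hb u)).mul_left 4).tsum_add
        (summable_mul_pow abs_besselCoeff_le u)]
    refine (tsum_congr fun n => ?_).trans tsum_zero
    simp only [b]
    linear_combination u ^ n * besselCoeff_succ n
  have hsq : ∀ x : ℝ, HasDerivAt (fun t : ℝ => t ^ 2) (2 * x) x := fun x => by
    simpa using hasDerivAt_pow 2 x
  have hJ : J₀ = fun x => F (x ^ 2) := funext J₀_eq_tsum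
  refine ⟨fun x => dF (x ^ 2) * (2 * x),
    fun x => ddF (x ^ 2) * (2 * x) * (2 * x) + dF (x ^ 2) * 2, fun x => ?_, fun x => ?_,
    fun x => ?_⟩
  · rw [hJ]
    exact (hF (x ^ 2)).comp x (hsq x)
  · exact ((hdF (x ^ 2)).comp x (hsq x)).mul
      (((hasDerivAt_id x).const_mul 2).congr_deriv (mul_one 2))
  · rw [hJ]
    linear_combination x ^ 2 * hode (x ^ 2)

/-- For every `(r₀,s₀)` with `r₀ + s₀ = 0`, the function `φ(x,y) = x^{r₀} y^{s₀} J₀(x)`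
satisfies the Bessel PDE of type I:
`x² z_xx + 2xy z_xy + y² z_yy + x z_x + y z_y + x² z = 0` for `x, y > 0`. -/
theorem bessel_pde_type_I_solution (r₀ s₀ : ℝ) (h : r₀ + s₀ = 0) :
    ∀ x y : ℝ, 0 < x → 0 < y →
      x ^ 2 * pdx (pdx (fun x y => x ^ r₀ * y ^ s₀ * J₀ x)) x y
      + 2 * x * y * pdx (pdy (fun x y => x ^ r₀ * y ^ s₀ * J₀ x)) x y
      + y ^ 2 * pdy (pdy (fun x y => x ^ r₀ * y ^ s₀ * J₀ x)) x y
      + x * pdx (fun x y => x ^ r₀ * y ^ s₀ * J₀ x) x y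
      + y * pdy (fun x y => x ^ r₀ * y ^ s₀ * J₀ x) x y
      + x ^ 2 * (x ^ r₀ * y ^ s₀ * J₀ x) = 0 := by
  intro x y hx hy
  obtain ⟨dJ, ddJ, hJ, hdJ, hode⟩ := exists_hasDerivAt_J₀
  have hrpow : ∀ a t : ℝ, 0 < t → HasDerivAt (fun v : ℝ => v ^ a) (a * t ^ (a - 1)) t :=
    fun a t ht => Real.hasDerivAt_rpow_const (Or.inl ht.ne')
  have hzx : ∀ t, 0 < t → pdx (fun x y => x ^ r₀ * y ^ s₀ * J₀ x) t y =
      r₀ * t ^ (r₀ - 1) * y ^ s₀ * J₀ t + t ^ r₀ * y ^ s₀ * dJ t := fun t ht =>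
    (((hrpow r₀ t ht).mul_const (y ^ s₀)).mul (hJ t)).deriv
  have hzy : ∀ t v, 0 < v → pdy (fun x y => x ^ r₀ * y ^ s₀ * J₀ x) t v =
      t ^ r₀ * (s₀ * v ^ (s₀ - 1)) * J₀ t := fun t v hv =>
    (((hrpow s₀ v hv).const_mul (t ^ r₀)).mul_const (J₀ t)).deriv
  have hzxx : pdx (pdx (fun x y => x ^ r₀ * y ^ s₀ * J₀ x)) x y =
      (r₀ * ((r₀ - 1) * x ^ (r₀ - 1 - 1)) * y ^ s₀ * J₀ x + r₀ * x ^ (r₀ - 1) * y ^ s₀ * dJ x) +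
      (r₀ * x ^ (r₀ - 1) * y ^ s₀ * dJ x + x ^ r₀ * y ^ s₀ * ddJ x) := by
    refine HasDerivAt.deriv (HasDerivAt.congr_of_eventuallyEq ?_
      ((eventually_gt_nhds hx).mono hzx))
    exact ((((hrpow (r₀ - 1) x hx).const_mul r₀).mul_const (y ^ s₀)).mul (hJ x)).add
      (((hrpow r₀ x hx).mul_const (y ^ s₀)).mul (hdJ x))
  have hzxy : pdx (pdy (fun x y => x ^ r₀ * y ^ s₀ * J₀ x)) x y =
      r₀ * x ^ (r₀ - 1) * (s₀ * y ^ (s₀ - 1)) * J₀ x +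
      x ^ r₀ * (s₀ * y ^ (s₀ - 1)) * dJ x := by
    refine HasDerivAt.deriv (HasDerivAt.congr_of_eventuallyEq ?_
      (Filter.Eventually.of_forall fun t => hzy t y hy))
    exact ((hrpow r₀ x hx).mul_const (s₀ * y ^ (s₀ - 1))).mul (hJ x)
  have hzyy : pdy (pdy (fun x y => x ^ r₀ * y ^ s₀ * J₀ x)) x y =
      x ^ r₀ * (s₀ * ((s₀ - 1) * y ^ (s₀ - 1 - 1))) * J₀ x := by
    refine HasDerivAt.deriv (HasDerivAt.congr_of_eventuallyEq ?_
      ((eventually_gt_nhds hy).mono (hzy x)))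
    exact (((hrpow (s₀ - 1) y hy).const_mul s₀).const_mul (x ^ r₀)).mul_const (J₀ x)
  rw [hzxx, hzxy, hzyy, hzx x hx, hzy x y hy]
  obtain rfl : s₀ = -r₀ := by linarith
  simp only [Real.rpow_sub_one hx.ne', Real.rpow_sub_one hy.ne']
  field_simp
  linear_combination x ^ r₀ * y ^ (-r₀) * hode x
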